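/- Sufficient condition for normality (iii): with the Hartwig–Spindelböck decomposition data as in the context, assuming K is invertible, with A_e := Û · fromBlocks(Σ₁K, Σ₁L, 0, 0) · Û* (the essential part of Â) and A_e^# := Û · fromBlocks(K⁻¹Σ₁⁻¹, K⁻¹Σ₁⁻¹K⁻¹L, 0, 0) · Û* (the group inverse of A_e), if A_e·Â*·A_e^# = Â*·A_e^#·A_e, then Â is normal (Â·Â* = Â*·Â). -/

import Mathlib

open Matrix

/-- The dual complex numbers `𝔻ℂ := ℂ[ε]`, the trivial square-zero extension of `ℂ` by `ℂ`. -/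
abbrev DC := TrivSqZeroExt ℂ ℂ

/-- Star on dual complex numbers: `(a + b·ε)* = conj a + conj b · ε`. -/
instance : Star DC :=
  ⟨fun x => ((starRingEnd ℂ) x.fst, (starRingEnd ℂ) x.snd)⟩

/-- A positive appreciable real dual number: the standard part is a positive real and
the dual part is real. -/
def PosAppreciable (x : DC) : Prop :=
  (∃ a : ℝ, 0 < a ∧ x.fst = (a : ℂ)) ∧ (∃ b : ℝ, x.snd = (b : ℂ))

/-- A nonnegative infinitesimal real dual number: the standard part is `0` and
the dual part is a nonnegative real. -/
def NonnegInfinitesimal (x : DC) : Prop :=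
  x.fst = 0 ∧ ∃ b : ℝ, 0 ≤ b ∧ x.snd = (b : ℂ)

/-- The standard part of a dual complex matrix. -/
def stdPart {m n : Type*} (X : Matrix m n DC) : Matrix m n ℂ :=
  X.map TrivSqZeroExt.fst

/-- The dual part of a dual complex matrix. -/
def dualPart {m n : Type*} (X : Matrix m n DC) : Matrix m n ℂ :=
  X.map TrivSqZeroExt.snd

/-- The coefficientwise conjugation makes the dual complex numbers a star ring. -/
instance : StarRing DC where
  star_involutive x := TrivSqZeroExt.ext (Complex.conj_conj _) (Complex.conj_conj _)
  star_mul x y := by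
    refine TrivSqZeroExt.ext ?_ ?_
    · change (starRingEnd ℂ) (x * y).fst = (starRingEnd ℂ) y.fst * (starRingEnd ℂ) x.fst
      rw [TrivSqZeroExt.fst_mul, map_mul, mul_comm]
    · change (starRingEnd ℂ) (x * y).snd = (starRingEnd ℂ) y.fst • (starRingEnd ℂ) x.snd +
        MulOpposite.op ((starRingEnd ℂ) x.fst) • (starRingEnd ℂ) y.snd
      rw [TrivSqZeroExt.snd_mul]
      simp only [smul_eq_mul, op_smul_eq_mul, map_add, map_mul]
      ring
  star_add x y := TrivSqZeroExt.ext (map_add (starRingEnd ℂ) _ _) (map_add (starRingEnd ℂ) _ _)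

lemma PosAppreciable.star_eq {x : DC} (hx : PosAppreciable x) : star x = x := by
  obtain ⟨⟨a, -, ha⟩, b, hb⟩ := hx
  refine TrivSqZeroExt.ext ?_ ?_
  · change (starRingEnd ℂ) x.fst = x.fst
    rw [ha, Complex.conj_ofReal]
  · change (starRingEnd ℂ) x.snd = x.snd
    rw [hb, Complex.conj_ofReal]

lemma PosAppreciable.isUnit {x : DC} (hx : PosAppreciable x) : IsUnit x := by
  obtain ⟨⟨a, ha₀, ha⟩, -⟩ := hx
  rw [TrivSqZeroExt.isUnit_iff_isUnit_fst, ha, isUnit_iff_ne_zero]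
  exact_mod_cast ha₀.ne'

lemma NonnegInfinitesimal.star_eq {x : DC} (hx : NonnegInfinitesimal x) : star x = x := by
  obtain ⟨ha, b, -, hb⟩ := hx
  refine TrivSqZeroExt.ext ?_ ?_
  · change (starRingEnd ℂ) x.fst = x.fst
    rw [ha, map_zero]
  · change (starRingEnd ℂ) x.snd = x.snd
    rw [hb, Complex.conj_ofReal]

lemma NonnegInfinitesimal.mul_self_eq_zero {x : DC} (hx : NonnegInfinitesimal x) :
    x * x = 0 := by
  refine TrivSqZeroExt.ext ?_ ?_ <;> simp [hx.1]

/-- A block matrix `[S₁K, S₁L; S₂M, S₂N]` with `[K, L; M, N]` unitary, `S₁` and `S₂` Hermitian,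
`S₁` and `K` invertible and `S₂ ^ 2 = 0` is normal as soon as its adjoint satisfies the
commutation identity with the top block row and the group inverse of the latter. -/
lemma fromBlocks_normal_of_essential_comm {m n R : Type*} [Fintype m] [Fintype n]
    [DecidableEq m] [DecidableEq n] [CommRing R] [StarRing R]
    {K S₁ : Matrix m m R} {L : Matrix m n R} {M : Matrix n m R} {N S₂ : Matrix n n R}
    (hW₁ : fromBlocks K L M N * (fromBlocks K L M N)ᴴ = 1)
    (hW₂ : (fromBlocks K L M N)ᴴ * fromBlocks K L M N = 1)
    (hS₁ : S₁.IsHermitian) (hS₁u : IsUnit S₁) (hS₂ : S₂.IsHermitian) (hS₂0 : S₂ * S₂ = 0)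
    (hK : IsUnit K)
    (h : fromBlocks (S₁ * K) (S₁ * L) 0 0 *
          (fromBlocks (S₁ * K) (S₁ * L) (S₂ * M) (S₂ * N))ᴴ *
          fromBlocks (K⁻¹ * S₁⁻¹) (K⁻¹ * S₁⁻¹ * K⁻¹ * L) 0 0 =
        (fromBlocks (S₁ * K) (S₁ * L) (S₂ * M) (S₂ * N))ᴴ *
          fromBlocks (K⁻¹ * S₁⁻¹) (K⁻¹ * S₁⁻¹ * K⁻¹ * L) 0 0 *
          fromBlocks (S₁ * K) (S₁ * L) 0 0) :
    fromBlocks (S₁ * K) (S₁ * L) (S₂ * M) (S₂ * N) *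
        (fromBlocks (S₁ * K) (S₁ * L) (S₂ * M) (S₂ * N))ᴴ =
      (fromBlocks (S₁ * K) (S₁ * L) (S₂ * M) (S₂ * N))ᴴ *
        fromBlocks (S₁ * K) (S₁ * L) (S₂ * M) (S₂ * N) := by
  have hKd := (isUnit_iff_isUnit_det K).mp hK
  have hSd := (isUnit_iff_isUnit_det S₁).mp hS₁u
  have hKi : K⁻¹ * K = 1 := nonsing_inv_mul K hKd
  have hSi : S₁⁻¹ * S₁ = 1 := nonsing_inv_mul S₁ hSd
  have hSi' : S₁ * S₁⁻¹ = 1 := mul_nonsing_inv S₁ hSd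
  have hcancel : K⁻¹ * (S₁⁻¹ * (S₁ * K)) = 1 := by
    rw [← Matrix.mul_assoc S₁⁻¹, hSi, Matrix.one_mul, hKi]
  simp only [fromBlocks_conjTranspose, fromBlocks_multiply, conjTranspose_mul, hS₁.eq, hS₂.eq,
    Matrix.mul_zero, Matrix.zero_mul, add_zero, fromBlocks_inj, Matrix.mul_assoc, hcancel,
    Matrix.mul_one] at h
  obtain ⟨h₁₁, -, h₂₁, -⟩ := h
  have hL : L = 0 := by
    have : Lᴴ = 0 := by
      rw [← Matrix.mul_one Lᴴ, ← hSi', ← Matrix.mul_assoc, ← h₂₁, Matrix.zero_mul]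
    rw [← conjTranspose_conjTranspose L, this, conjTranspose_zero]
  subst hL
  rw [← fromBlocks_one, fromBlocks_conjTranspose, fromBlocks_multiply, fromBlocks_inj] at hW₁ hW₂
  simp only [conjTranspose_zero, Matrix.mul_zero, Matrix.zero_mul, add_zero, zero_add]
    at hW₁ hW₂ h₁₁
  obtain ⟨hKK, -, hMK, -⟩ := hW₁
  have hKK' : Kᴴ * K = 1 := mul_eq_one_comm.mp hKK
  have hM : M = 0 := by
    rw [← Matrix.mul_one M, ← hKK', ← Matrix.mul_assoc, hMK, Matrix.zero_mul]
  subst hM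
  have hNN : N * Nᴴ = 1 := mul_eq_one_comm.mp hW₂.2.2.2
  have hKinv : K⁻¹ = Kᴴ := inv_eq_left_inv hKK'
  have hcomm : S₁ * (S₁ * Kᴴ) = Kᴴ * (S₁ * S₁) := by
    have hKMM : S₁ * (S₁ * (Kᴴ * S₁⁻¹)) = Kᴴ * S₁ := by
      simpa only [Matrix.mul_assoc, hKinv, ← Matrix.mul_assoc K Kᴴ, hKK, Matrix.one_mul] using h₁₁
    calc S₁ * (S₁ * Kᴴ) = S₁ * (S₁ * (Kᴴ * S₁⁻¹)) * S₁ := by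
          simp only [Matrix.mul_assoc, hSi, Matrix.mul_one]
      _ = Kᴴ * (S₁ * S₁) := by rw [hKMM, Matrix.mul_assoc]
  have hS₁K : Kᴴ * (S₁ * (S₁ * K)) = S₁ * S₁ := by
    rw [← Matrix.mul_assoc S₁, ← Matrix.mul_assoc, ← hcomm]
    simp only [Matrix.mul_assoc, hKK', Matrix.mul_one]
  simp only [fromBlocks_conjTranspose, fromBlocks_multiply, conjTranspose_mul, hS₁.eq, hS₂.eq,
    Matrix.mul_zero, Matrix.zero_mul, add_zero, zero_add, conjTranspose_zero]
  congr 1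
  · rw [Matrix.mul_assoc Kᴴ, hS₁K, Matrix.mul_assoc, ← Matrix.mul_assoc K, hKK, Matrix.one_mul]
  · rw [Matrix.mul_assoc, ← Matrix.mul_assoc N, hNN, Matrix.one_mul, Matrix.mul_assoc Nᴴ,
      ← Matrix.mul_assoc S₂, hS₂0, Matrix.zero_mul, Matrix.mul_zero]

/-- Sufficient condition for normality (iii). -/
theorem normal_of_essential_comm_i
    {r s : ℕ}
    -- `Û`, a unitary matrix
    (U : Matrix (Fin r ⊕ Fin s) (Fin r ⊕ Fin s) DC)
    (hU₁ : U * Uᴴ = 1) (hU₂ : Uᴴ * U = 1)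
    -- the blocks `K, L, M, N` forming a unitary block matrix
    (K : Matrix (Fin r) (Fin r) DC) (L : Matrix (Fin r) (Fin s) DC)
    (M : Matrix (Fin s) (Fin r) DC) (N : Matrix (Fin s) (Fin s) DC)
    (hW₁ : fromBlocks K L M N * (fromBlocks K L M N)ᴴ = 1)
    (hW₂ : (fromBlocks K L M N)ᴴ * fromBlocks K L M N = 1)
    -- `Σ₁` diagonal with positive appreciable real dual diagonal entries
    (S₁ : Matrix (Fin r) (Fin r) DC) (d₁ : Fin r → DC)
    (hS₁ : S₁ = Matrix.diagonal d₁) (hd₁ : ∀ i, PosAppreciable (d₁ i))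
    -- `Σ₂` diagonal with nonnegative infinitesimal real dual diagonal entries
    (S₂ : Matrix (Fin s) (Fin s) DC) (d₂ : Fin s → DC)
    (hS₂ : S₂ = Matrix.diagonal d₂) (hd₂ : ∀ i, NonnegInfinitesimal (d₂ i))
    -- the Hartwig–Spindelböck decomposition of `Â`
    (A : Matrix (Fin r ⊕ Fin s) (Fin r ⊕ Fin s) DC)
    (hA : A = U * fromBlocks (S₁ * K) (S₁ * L) (S₂ * M) (S₂ * N) * Uᴴ)
    -- `A_e`, the essential part of `Â`
    (Ae : Matrix (Fin r ⊕ Fin s) (Fin r ⊕ Fin s) DC)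
    (hAe : Ae = U * fromBlocks (S₁ * K) (S₁ * L) 0 0 * Uᴴ)
    -- `K` is invertible
    (hK : IsUnit K)
    -- `A_e^#`, the group inverse of the essential part
    (Aeg : Matrix (Fin r ⊕ Fin s) (Fin r ⊕ Fin s) DC)
    (hAeg : Aeg = U * fromBlocks (K⁻¹ * S₁⁻¹) (K⁻¹ * S₁⁻¹ * K⁻¹ * L) 0 0 * Uᴴ)
    (h : Ae * Aᴴ * Aeg = Aᴴ * Aeg * Ae) :
    A * Aᴴ = Aᴴ * A := by
  have hS₁H : S₁.IsHermitian := by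
    rw [hS₁]
    exact isHermitian_diagonal_iff.mpr fun i => (hd₁ i).star_eq
  have hS₂H : S₂.IsHermitian := by
    rw [hS₂]
    exact isHermitian_diagonal_iff.mpr fun i => (hd₂ i).star_eq
  have hS₁u : IsUnit S₁ := by
    rw [hS₁, isUnit_diagonal, Pi.isUnit_iff]
    exact fun i => (hd₁ i).isUnit
  have hS₂0 : S₂ * S₂ = 0 := by
    rw [hS₂, diagonal_mul_diagonal, ← diagonal_zero]
    exact congrArg diagonal (funext fun i => (hd₂ i).mul_self_eq_zero)
  have conj_mul (X Y : Matrix (Fin r ⊕ Fin s) (Fin r ⊕ Fin s) DC) :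
      U * X * Uᴴ * (U * Y * Uᴴ) = U * (X * Y) * Uᴴ := by
    rw [show U * X * Uᴴ * (U * Y * Uᴴ) = U * X * (Uᴴ * U) * Y * Uᴴ by
      simp only [Matrix.mul_assoc], hU₂, Matrix.mul_one, Matrix.mul_assoc U]
  have conj_inj {X Y : Matrix (Fin r ⊕ Fin s) (Fin r ⊕ Fin s) DC}
      (hXY : U * X * Uᴴ = U * Y * Uᴴ) : X = Y := by
    have key (Z : Matrix (Fin r ⊕ Fin s) (Fin r ⊕ Fin s) DC) : Uᴴ * (U * Z * Uᴴ) * U = Z := by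
      rw [show Uᴴ * (U * Z * Uᴴ) * U = Uᴴ * U * Z * (Uᴴ * U) by
        simp only [Matrix.mul_assoc], hU₂, Matrix.one_mul, Matrix.mul_one]
    rw [← key X, hXY, key]
  have hAH : Aᴴ = U * (fromBlocks (S₁ * K) (S₁ * L) (S₂ * M) (S₂ * N))ᴴ * Uᴴ := by
    rw [hA, conjTranspose_mul, conjTranspose_mul, conjTranspose_conjTranspose, Matrix.mul_assoc]
  rw [hAH, hAe, hAeg] at h
  simp only [conj_mul] at h
  rw [hAH, hA, conj_mul, conj_mul,
    fromBlocks_normal_of_essential_comm hW₁ hW₂ hS₁H hS₁u hS₂H hS₂0 hK (conj_inj h)]
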